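/- Let g : ℝ → [0,∞) be a measurable probability density supported on [0,∞) (that is, g(x) = 0 for x < 0 and ∫₀^∞ g(x) dx = 1) satisfying g(x) = 2·∫₀^∞ g(x+y)·g(y) dy for every x ≥ 0. Then there exists λ > 0 such that g(x) = λ·e^{−λx} for all x ≥ 0; that is, g is an exponential density. -/

import Mathlib

open MeasureTheory

open Set Filter Topology
open scoped ENNReal Pointwise

namespace ExpChar

noncomputable def P (G f : ℝ → ℝ≥0∞) (z : ℝ) : ℝ≥0∞ :=
  ∫⁻ x in Ioi (0:ℝ), f x * (G (x - z) + G (x + z))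

noncomputable def T (G : ℝ → ℝ≥0∞) (z : ℝ) : ℝ≥0∞ := ∫⁻ y in Ioi z, G y

lemma shift (h : ℝ → ℝ≥0∞) (z : ℝ) :
    ∫⁻ x in Ioi z, h x = ∫⁻ x in Ioi (0:ℝ), h (x + z) := by
  rw [← lintegral_indicator measurableSet_Ioi, ← lintegral_indicator measurableSet_Ioi,
    ← lintegral_add_right_eq_self _ z]
  congr 1; ext x
  by_cases hx : 0 < x <;> simp [indicator, hx]

lemma first_part (G f : ℝ → ℝ≥0∞) (hG0 : ∀ x ≤ 0, G x = 0) {z : ℝ} (hz : 0 ≤ z) :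
    ∫⁻ x in Ioi (0:ℝ), f x * G (x - z) = ∫⁻ y in Ioi (0:ℝ), f (y + z) * G y := by
  have : ∫⁻ x in Ioi (0:ℝ), f x * G (x - z) = ∫⁻ x in Ioi z, f x * G (x - z) := by
    rw [← lintegral_indicator measurableSet_Ioi, ← lintegral_indicator measurableSet_Ioi]
    congr 1; ext x
    by_cases hx : z < x
    · simp [indicator, hx, hz.trans_lt hx]
    · simp [indicator, hx, hG0 (x - z) (by linarith [not_lt.1 hx])]
  rw [this, shift]
  simp

lemma measP {G f : ℝ → ℝ≥0∞} (hG : Measurable G) (hf : Measurable f) : Measurable (P G f) := by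
  unfold P
  apply Measurable.lintegral_prod_right' (f := fun p : ℝ × ℝ => f p.2 * (G (p.2 - p.1) + G (p.2 + p.1)))
  fun_prop

lemma kernel_mass {G : ℝ → ℝ≥0∞} (hG : Measurable G) (h1 : ∫⁻ x, G x = 1) (x : ℝ) :
    ∫⁻ z in Ioi (0:ℝ), (G (x - z) + G (x + z)) = 1 := by
  rw [lintegral_add_left (by fun_prop)]
  have : ∫⁻ z in Ioi (0:ℝ), G (x - z) = ∫⁻ z in Iic (0:ℝ), G (x + z) := by
    rw [← restrict_Iio_eq_restrict_Iic, ← lintegral_indicator measurableSet_Ioi,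
      ← lintegral_indicator measurableSet_Iio, ← lintegral_neg_eq_self]
    congr 1; ext y
    by_cases hy : y < 0 <;> simp [indicator, hy]
  rw [this]
  have h := lintegral_add_compl (μ := volume) (fun z => G (x + z)) (measurableSet_Iic (a := (0:ℝ)))
  rw [compl_Iic] at h
  rw [h, lintegral_add_left_eq_self, h1]

lemma mass {G f : ℝ → ℝ≥0∞} (hG : Measurable G) (h1 : ∫⁻ x, G x = 1) (hf : Measurable f) :
    ∫⁻ z in Ioi (0:ℝ), P G f z = ∫⁻ x in Ioi (0:ℝ), f x := by
  unfold P
  rw [lintegral_lintegral_swap (by fun_prop)]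
  congr 1; ext x
  rw [lintegral_const_mul _ (by fun_prop), kernel_mass hG h1, mul_one]

lemma P_split {G f : ℝ → ℝ≥0∞} (hG : Measurable G) (hG0 : ∀ x ≤ 0, G x = 0)
    (hf : Measurable f) {z : ℝ} (hz : 0 ≤ z) :
    P G f z = (∫⁻ y in Ioi (0:ℝ), f (y + z) * G y) + ∫⁻ y in Ioi (0:ℝ), f y * G (y + z) := by
  unfold P
  simp_rw [mul_add]
  rw [lintegral_add_left (by fun_prop), first_part G f hG0 hz]

lemma P_self {G : ℝ → ℝ≥0∞} (hG : Measurable G) (hG0 : ∀ x ≤ 0, G x = 0) {z : ℝ} (hz : 0 ≤ z) :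
    P G G z = 2 * ∫⁻ y in Ioi (0:ℝ), G (z + y) * G y := by
  rw [P_split hG hG0 hG hz, two_mul]
  congr 2 <;> ext y <;> simp [add_comm, mul_comm]

lemma T_anti (G : ℝ → ℝ≥0∞) : Antitone (T G) := fun _ _ h =>
  lintegral_mono_set (Ioi_subset_Ioi h)

lemma T_meas (G : ℝ → ℝ≥0∞) : Measurable (T G) := (T_anti G).measurable

lemma T_le {G : ℝ → ℝ≥0∞} (h1 : ∫⁻ x, G x = 1) (x : ℝ) : T G x ≤ 1 :=
  h1 ▸ setLIntegral_le_lintegral _ _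

lemma T_zero {G : ℝ → ℝ≥0∞} (hG0 : ∀ x ≤ 0, G x = 0) (h1 : ∫⁻ x, G x = 1) : T G 0 = 1 := by
  rw [T, ← lintegral_indicator measurableSet_Ioi, ← h1]
  congr 1; ext x
  by_cases hx : 0 < x
  · simp [indicator, hx]
  · simp [indicator, hx, hG0 x (not_lt.1 hx)]

lemma P_T {G : ℝ → ℝ≥0∞} (hG : Measurable G) (hG0 : ∀ x ≤ 0, G x = 0) (h1 : ∫⁻ x, G x = 1)
    {z : ℝ} (hz : 0 ≤ z) : P G (T G) z = T G z := by
  rw [P_split hG hG0 (T_meas G) hz]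
  have hTm := T_meas G
  -- first term
  have e1 : ∫⁻ y in Ioi (0:ℝ), T G (y + z) * G y
      = ∫⁻ y in Ioi (0:ℝ), ∫⁻ x in Ioi (0:ℝ), (Ioi y).indicator (fun x => G (x + z) * G y) x := by
    refine setLIntegral_congr_fun measurableSet_Ioi fun y hy => ?_
    have hy : 0 < y := hy
    rw [lintegral_indicator measurableSet_Ioi, Measure.restrict_restrict measurableSet_Ioi,
      inter_eq_left.2 (Ioi_subset_Ioi hy.le), lintegral_mul_const _ (by fun_prop)]
    congr 1
    rw [T, shift G, shift _ y]
    simp [add_assoc]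
  have e2 : ∫⁻ y in Ioi (0:ℝ), T G y * G (y + z)
      = ∫⁻ y in Ioi (0:ℝ), ∫⁻ x in Ioi (0:ℝ), (Iic y).indicator (fun x => G (x + z) * G y) x := by
    have : ∫⁻ y in Ioi (0:ℝ), T G y * G (y + z)
      = ∫⁻ y in Ioi (0:ℝ), ∫⁻ x in Ioi (0:ℝ), (Ici y).indicator (fun x => G x * G (y + z)) x := by
      refine setLIntegral_congr_fun measurableSet_Ioi fun y hy => ?_
      have hy : 0 < y := hy
      rw [lintegral_indicator measurableSet_Ici, Measure.restrict_restrict measurableSet_Ici,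
        inter_eq_left.2 (Ici_subset_Ioi.2 hy), lintegral_mul_const _ (by fun_prop),
        ← restrict_Ioi_eq_restrict_Ici, T]
    rw [this, lintegral_lintegral_swap]
    · congr 1; ext y
      congr 1; ext x
      by_cases h : x ≤ y <;> simp [indicator, h, mul_comm]
    · apply Measurable.aemeasurable
      have : (Function.uncurry fun y x => (Ici y).indicator (fun x => G x * G (y + z)) x)
          = {p : ℝ × ℝ | p.1 ≤ p.2}.indicator (fun p => G p.2 * G (p.1 + z)) := by
        ext p; simp [indicator, Function.uncurry]
      rw [this]
      exact Measurable.indicator (by fun_prop) (measurableSet_le measurable_fst measurable_snd)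
  rw [e1, e2, ← lintegral_add_left]
  · have : ∀ y : ℝ, (∫⁻ x in Ioi (0:ℝ), (Ioi y).indicator (fun x => G (x + z) * G y) x) +
       (∫⁻ x in Ioi (0:ℝ), (Iic y).indicator (fun x => G (x + z) * G y) x) = T G z * G y := by
      intro y
      rw [← lintegral_add_left ((by fun_prop : Measurable fun x => G (x + z) * G y).indicator measurableSet_Ioi)]
      rw [T, shift G z, ← lintegral_mul_const _ (by fun_prop)]
      congr 1; ext x
      by_cases h : x ≤ y
      · simp [indicator, h, not_lt.2 h]
      · simp [indicator, h, not_le.1 h]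
    simp_rw [this]
    rw [lintegral_const_mul _ hG]
    have := T_zero hG0 h1
    rw [T] at this
    rw [this, mul_one]
  · have : (Function.uncurry fun y x => (Ioi y).indicator (fun x => G (x + z) * G y) x)
          = {p : ℝ × ℝ | p.1 < p.2}.indicator (fun p => G (p.2 + z) * G p.1) := by
        ext p; simp [indicator, Function.uncurry]
    apply Measurable.lintegral_prod_right
    rw [this]
    exact Measurable.indicator (by fun_prop) (measurableSet_lt measurable_fst measurable_snd)

/-- Steinhaus-type lemma. -/
lemma overlap {C : Set ℝ} (hC : MeasurableSet C) (hpos : volume C ≠ 0) :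
    ∃ ε > 0, ∀ z : ℝ, 0 < z → z < ε → volume (C ∩ {x | z + x ∈ C}) ≠ 0 := by
  obtain ⟨K, hKC, hK, hKpos⟩ := hC.exists_lt_isCompact (μ := volume) (pos_iff_ne_zero.2 hpos)
  have h := eventually_nhds_zero_measure_vadd_sdiff_lt (μ := (volume : Measure ℝ)) hK hK.isClosed hKpos.ne'
  obtain ⟨ε, hε, h⟩ := Metric.eventually_nhds_iff.1 h
  refine ⟨ε, hε, fun z hz hzε h0 => ?_⟩
  have h' := @h (-z) (by simpa [abs_of_pos hz] using hzε)
  have hle : volume ((-z) +ᵥ K) ≤ volume (((-z) +ᵥ K) \ K) + volume (C ∩ {x | z + x ∈ C}) := by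
    refine (measure_mono ?_).trans (measure_union_le _ _)
    rintro x ⟨k, hk, rfl⟩
    by_cases hx : (-z) +ᵥ k ∈ K
    · right; exact ⟨hKC hx, by simpa using hKC hk⟩
    · left; exact ⟨⟨k, hk, rfl⟩, hx⟩
  rw [h0, add_zero, measure_vadd] at hle
  exact absurd h' (not_lt.2 hle)


lemma gpos {G : ℝ → ℝ≥0∞} (hG : Measurable G) (hG0 : ∀ x ≤ 0, G x = 0) (h1 : ∫⁻ x, G x = 1)
    (hinv : ∀ᵐ z : ℝ, 0 < z → P G G z = G z) :
    ∃ ε > 0, ∀ᵐ z : ℝ, 0 < z → z < ε → G z ≠ 0 := by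
  have hC : MeasurableSet {x | G x ≠ 0} := hG (measurableSet_singleton 0).compl
  have hpos : volume {x | G x ≠ 0} ≠ 0 := by
    intro h
    have : ∀ᵐ x : ℝ, G x = 0 := by rw [ae_iff]; exact h
    rw [lintegral_congr_ae this] at h1
    simp at h1
  obtain ⟨ε, hε, h⟩ := overlap hC hpos
  refine ⟨ε, hε, ?_⟩
  filter_upwards [hinv] with z hz hz0 hzε h0
  refine h z hz0 hzε ?_
  rw [← hz hz0, P_self hG hG0 hz0.le] at h0
  have h0 : ∫⁻ y in Ioi (0:ℝ), G (z + y) * G y = 0 := by simpa using h0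
  rw [setLIntegral_eq_zero_iff measurableSet_Ioi (by fun_prop)] at h0
  have : ∀ᵐ y : ℝ, ¬ (y ∈ {x | G x ≠ 0} ∩ {x | z + x ∈ {x | G x ≠ 0}}) := by
    filter_upwards [h0] with y hy hy2
    have hy0 : 0 < y := by
      by_contra hc
      exact hy2.1 (hG0 y (not_lt.1 hc))
    have := hy hy0
    rcases mul_eq_zero.1 this with h | h
    · exact hy2.2 h
    · exact hy2.1 h
  exact measure_eq_zero_iff_ae_notMem.2 this

lemma step {G f : ℝ → ℝ≥0∞} (hG : Measurable G) (hf : Measurable f) {ε : ℝ}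
    (hε : ∀ᵐ z : ℝ, 0 < z → z < ε → G z ≠ 0) {a b : ℝ}
    (hA : ¬ ∀ᵐ x : ℝ, a < x → x < b → f x = 0) {z : ℝ} (hz : 0 < z) (hza : z ≤ a)
    (hzb : b ≤ z + ε) : P G f z ≠ 0 := by
  intro h0
  apply hA
  unfold P at h0
  rw [setLIntegral_eq_zero_iff measurableSet_Ioi (by fun_prop)] at h0
  have h2 := (measurePreserving_sub_right (volume : Measure ℝ) z).quasiMeasurePreserving.ae hε
  filter_upwards [h0, h2] with x hx hx2 hax hxb
  have := hx (show 0 < x by linarith)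
  rcases mul_eq_zero.1 this with h | h
  · exact h
  · exact absurd (add_eq_zero.1 h).1 (hx2 (by linarith) (by linarith))

lemma pos_near {G f : ℝ → ℝ≥0∞} (hG : Measurable G) (hf : Measurable f) {ε : ℝ} (hε0 : 0 < ε)
    (hε : ∀ᵐ z : ℝ, 0 < z → z < ε → G z ≠ 0) (hinv : ∀ᵐ z : ℝ, 0 < z → P G f z = f z)
    (hne : ¬ ∀ᵐ x : ℝ, 0 < x → f x = 0) :
    ∃ δ > 0, ∀ᵐ z : ℝ, 0 < z → z < δ → f z ≠ 0 := by
  set h := ε / 2 with hh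
  have hh0 : 0 < h := by positivity
  have key : ∀ n : ℕ, (¬ ∀ᵐ x : ℝ, n * h < x → x < (n + 1) * h → f x = 0) →
      ¬ ∀ᵐ x : ℝ, 0 < x → x < h → f x = 0 := by
    intro n
    induction n with
    | zero => intro H; simpa using H
    | succ n ih =>
      intro H
      apply ih
      intro H2
      have : ∀ᵐ x : ℝ, ¬ (x ∈ Ioo (n * h) ((n + 1) * h)) := by
        filter_upwards [H2, hinv] with x hx hx2 hx3
        have h0 : 0 < x := lt_of_le_of_lt (by positivity) hx3.1
        have := hx hx3.1 hx3.2
        rw [← hx2 h0] at this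
        refine step hG hf hε H h0 ?_ ?_ this
        · push_cast; exact hx3.2.le
        · push_cast; nlinarith [hx3.1]
      have hv : volume (Ioo (n * h) ((n + 1) * h)) = 0 := measure_eq_zero_iff_ae_notMem.2 this
      rw [Real.volume_Ioo, ENNReal.ofReal_eq_zero] at hv
      nlinarith
  have h1 : ¬ ∀ᵐ x : ℝ, 0 < x → x < h → f x = 0 := by
    by_contra hcon
    apply hne
    have hall : ∀ n : ℕ, ∀ᵐ x : ℝ, n * h < x → x < (n + 1) * h → f x = 0 := by
      intro n
      by_contra hc
      exact key n hc hcon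
    have hnull : ∀ n : ℕ, ∀ᵐ x : ℝ, x ≠ n * h := fun n => by simp [ae_iff]
    filter_upwards [ae_all_iff.2 hall, ae_all_iff.2 hnull] with x hx hx2 hx0
    have hfl := Nat.floor_le (div_pos hx0 hh0).le
    have hlt := Nat.lt_floor_add_one (x / h)
    refine hx ⌊x / h⌋₊ (lt_of_le_of_ne ?_ (hx2 _).symm) ?_
    · rwa [le_div_iff₀ hh0] at hfl
    · rwa [div_lt_iff₀ hh0] at hlt
  obtain ⟨n, hn⟩ : ∃ n : ℕ, ¬ ∀ᵐ x : ℝ, 1 / ((n : ℝ) + 1) < x → x < h → f x = 0 := by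
    by_contra! hc
    apply h1
    filter_upwards [ae_all_iff.2 hc] with x hx hx0 hxh
    obtain ⟨n, hn⟩ := exists_nat_one_div_lt hx0
    exact hx n hn hxh
  refine ⟨1 / ((n : ℝ) + 1), by positivity, ?_⟩
  filter_upwards [hinv] with z hz hz0 hzd
  rw [← hz hz0]
  exact step hG hf hε hn hz0 hzd.le (by linarith)

/-- comparison: if `a - b` is zero or positive near zero, same for `b - a`, and the integrals
over `(0,1)` agree, then `a ≤ b`. -/
lemma compare {a b : ℝ → ℝ≥0∞} (ha : Measurable a) (hb : Measurable b)
    (hfa : ∫⁻ x in Ioo (0:ℝ) 1, a x ≠ ⊤)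
    (hint : ∫⁻ x in Ioo (0:ℝ) 1, a x = ∫⁻ x in Ioo (0:ℝ) 1, b x)
    (h1 : (¬ ∀ᵐ x : ℝ, 0 < x → a x - b x = 0) →
      ∃ δ > 0, ∀ᵐ z : ℝ, 0 < z → z < δ → a z - b z ≠ 0)
    (h2 : (¬ ∀ᵐ x : ℝ, 0 < x → b x - a x = 0) →
      ∃ δ > 0, ∀ᵐ z : ℝ, 0 < z → z < δ → b z - a z ≠ 0) :
    ∀ᵐ x : ℝ, 0 < x → a x ≤ b x := by
  by_contra hne
  simp only [tsub_eq_zero_iff_le] at h1 h2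
  obtain ⟨δ, hδ, h⟩ := h1 hne
  have hfalse : ∀ r > (0:ℝ), ¬ ∀ᵐ x : ℝ, ¬ (x ∈ Ioo 0 r) := by
    intro r hr h
    have hv : volume (Ioo 0 r) = 0 := measure_eq_zero_iff_ae_notMem.2 h
    rw [Real.volume_Ioo, ENNReal.ofReal_eq_zero] at hv
    linarith
  have hba : ∀ᵐ x : ℝ, 0 < x → b x ≤ a x := by
    by_contra hne2
    obtain ⟨δ', hδ', h'⟩ := h2 hne2
    apply hfalse (min δ δ') (lt_min hδ hδ')
    filter_upwards [h, h'] with x hx hx' hxm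
    have q1 := hx hxm.1 (hxm.2.trans_le (min_le_left _ _))
    have q2 := hx' hxm.1 (hxm.2.trans_le (min_le_right _ _))
    rw [ne_eq, tsub_eq_zero_iff_le] at q1 q2
    exact q1 (not_le.1 q2).le
  have hle : b ≤ᵐ[volume.restrict (Ioo (0:ℝ) 1)] a := by
    rw [EventuallyLE, ae_restrict_iff' measurableSet_Ioo]
    filter_upwards [hba] with x hx hx1 using hx hx1.1
  have heq := ae_eq_of_ae_le_of_lintegral_le hle (hint ▸ hfa) ha.aemeasurable hint.le
  rw [EventuallyEq, ae_restrict_iff' measurableSet_Ioo] at heq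
  apply hfalse (min δ 1) (lt_min hδ one_pos)
  filter_upwards [h, heq] with x hx hx' hxm
  exact hx hxm.1 (hxm.2.trans_le (min_le_left _ _))
    (tsub_eq_zero_of_le (hx' ⟨hxm.1, hxm.2.trans_le (min_le_right _ _)⟩).ge)

lemma P_mono {G f f' : ℝ → ℝ≥0∞} (h : ∀ x, f x ≤ f' x) (z : ℝ) : P G f z ≤ P G f' z :=
  lintegral_mono fun x => mul_le_mul_left (h x) _

lemma P_add {G f f' : ℝ → ℝ≥0∞} (hG : Measurable G) (hf : Measurable f) (z : ℝ) :
    P G (fun x => f x + f' x) z = P G f z + P G f' z := by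
  unfold P
  simp_rw [add_mul]
  rw [lintegral_add_left (by fun_prop)]

lemma P_const {G f : ℝ → ℝ≥0∞} (hG : Measurable G) (hf : Measurable f) (c : ℝ≥0∞) (z : ℝ) :
    P G (fun x => c * f x) z = c * P G f z := by
  unfold P
  simp_rw [mul_assoc]
  rw [lintegral_const_mul _ (by fun_prop)]

lemma P_diff {G f m : ℝ → ℝ≥0∞} (hG : Measurable G) (hm : Measurable m)
    (hle : ∀ x, m x ≤ f x) (hfin : ∀ x, m x ≠ ⊤)
    (hinvf : ∀ᵐ z : ℝ, 0 < z → P G f z = f z) (hinvm : ∀ᵐ z : ℝ, 0 < z → P G m z = m z) :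
    ∀ᵐ z : ℝ, 0 < z → P G (fun x => f x - m x) z = f z - m z := by
  filter_upwards [hinvf, hinvm] with z h1 h2 hz
  have := P_add (f := m) (f' := fun x => f x - m x) hG hm z
  have e : (fun x => m x + (f x - m x)) = f := by
    ext x; exact add_tsub_cancel_of_le (hle x)
  rw [e, h1 hz, h2 hz] at this
  rw [this, ENNReal.add_sub_cancel_left (hfin z)]

lemma main_ae {G : ℝ → ℝ≥0∞} (hG : Measurable G) (hG0 : ∀ x ≤ 0, G x = 0) (h1 : ∫⁻ x, G x = 1)
    (hfin : ∀ x, G x ≠ ⊤) (hinv : ∀ᵐ z : ℝ, 0 < z → P G G z = G z) :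
    ∃ c : ℝ≥0∞, c ≠ ⊤ ∧ ∀ᵐ x : ℝ, 0 < x → G x = c * T G x := by
  have hTm := T_meas G
  have hT0 : ∫⁻ x in Ioo (0:ℝ) 1, T G x ≠ 0 := by
    intro h0
    rw [setLIntegral_eq_zero_iff measurableSet_Ioo hTm] at h0
    have hz : ∀ r : ℝ, 0 < r → T G r = 0 := by
      intro r hr
      by_contra hc
      have : ∀ᵐ x : ℝ, ¬ (x ∈ Ioo 0 (min r 1)) := by
        filter_upwards [h0] with x hx hx2
        have e := hx ⟨hx2.1, hx2.2.trans_le (min_le_right _ _)⟩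
        have := T_anti G (hx2.2.trans_le (min_le_left _ _)).le
        rw [e] at this
        exact hc (le_zero_iff.1 this)
      have hv : volume (Ioo 0 (min r 1)) = 0 := measure_eq_zero_iff_ae_notMem.2 this
      rw [Real.volume_Ioo, ENNReal.ofReal_eq_zero] at hv
      have := lt_min hr one_pos
      linarith
    have hG : ∀ n : ℕ, ∀ᵐ x : ℝ, 1 / ((n : ℝ) + 1) < x → G x = 0 := by
      intro n
      have := hz (1 / ((n : ℝ) + 1)) (by positivity)
      rw [T, setLIntegral_eq_zero_iff measurableSet_Ioi hG] at this
      exact this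
    have : ∀ᵐ x : ℝ, G x = 0 := by
      filter_upwards [ae_all_iff.2 hG] with x hx
      rcases le_or_gt x 0 with h | h
      · exact hG0 x h
      · obtain ⟨n, hn⟩ := exists_nat_one_div_lt h
        exact hx n hn
    rw [lintegral_congr_ae this] at h1
    simp at h1
  have hT1 : ∫⁻ x in Ioo (0:ℝ) 1, T G x ≠ ⊤ := by
    refine ne_top_of_le_ne_top ENNReal.one_ne_top ?_
    calc ∫⁻ x in Ioo (0:ℝ) 1, T G x ≤ ∫⁻ x in Ioo (0:ℝ) 1, 1 := lintegral_mono fun x => T_le h1 x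
      _ = 1 := by simp
  have hGi : ∫⁻ x in Ioo (0:ℝ) 1, G x ≠ ⊤ :=
    ne_top_of_le_ne_top ENNReal.one_ne_top (h1 ▸ setLIntegral_le_lintegral _ _)
  set c := (∫⁻ x in Ioo (0:ℝ) 1, G x) / ∫⁻ x in Ioo (0:ℝ) 1, T G x with hc
  have hctop : c ≠ ⊤ := ENNReal.div_ne_top hGi hT0
  have hint : ∫⁻ x in Ioo (0:ℝ) 1, G x = ∫⁻ x in Ioo (0:ℝ) 1, c * T G x := by
    rw [lintegral_const_mul _ hTm, hc, ENNReal.div_mul_cancel hT0 hT1]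
  refine ⟨c, hctop, ?_⟩
  obtain ⟨ε, hε0, hε⟩ := gpos hG hG0 h1 hinv
  have hcT : Measurable fun x => c * T G x := by fun_prop
  have hinvT : ∀ᵐ z : ℝ, 0 < z → P G (fun x => c * T G x) z = c * T G z :=
    Eventually.of_forall fun z hz => by rw [P_const hG hTm, P_T hG hG0 h1 hz.le]
  set m : ℝ → ℝ≥0∞ := fun x => min (G x) (c * T G x) with hmdef
  have hm : Measurable m := hG.min hcT
  have hmfin : ∀ x, m x ≠ ⊤ := fun x => ne_top_of_le_ne_top (hfin x) (min_le_left _ _)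
  have hinvm : ∀ᵐ z : ℝ, 0 < z → P G m z = m z := by
    have hle : P G m ≤ᵐ[volume.restrict (Ioi (0:ℝ))] m := by
      rw [EventuallyLE, ae_restrict_iff' measurableSet_Ioi]
      filter_upwards [hinv, hinvT] with z hz1 hz2 hz
      refine le_min ?_ ?_
      · rw [← hz1 hz]; exact P_mono (fun x => min_le_left _ _) z
      · rw [← hz2 hz]; exact P_mono (fun x => min_le_right _ _) z
    have hmass := mass hG h1 hm
    have hmi : ∫⁻ x in Ioi (0:ℝ), m x ≠ ⊤ := by
      refine ne_top_of_le_ne_top ENNReal.one_ne_top ?_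
      calc ∫⁻ x in Ioi (0:ℝ), m x ≤ ∫⁻ x in Ioi (0:ℝ), G x := lintegral_mono fun x => min_le_left _ _
        _ ≤ 1 := h1 ▸ setLIntegral_le_lintegral _ _
    have := ae_eq_of_ae_le_of_lintegral_le hle (hmass ▸ hmi) hm.aemeasurable hmass.ge
    rwa [EventuallyEq, ae_restrict_iff' measurableSet_Ioi] at this
  have d1 := P_diff hG hm (fun x => min_le_left _ _) hmfin hinv hinvm
  have d2 := P_diff hG hm (fun x => min_le_right _ _) hmfin hinvT hinvm
  have e1 : (fun x => G x - m x) = fun x => G x - c * T G x := by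
    ext x; simp only [hmdef]
    rcases le_total (G x) (c * T G x) with h | h <;> simp [h, tsub_eq_zero_of_le]
  have e2 : (fun x => c * T G x - m x) = fun x => c * T G x - G x := by
    ext x; simp only [hmdef]
    rcases le_total (G x) (c * T G x) with h | h <;> simp [h, tsub_eq_zero_of_le]
  have p1 := pos_near hG (hG.sub hm) hε0 hε d1
  have p2 := pos_near hG (hcT.sub hm) hε0 hε d2
  simp only [Pi.sub_def, congrFun e1, congrFun e2] at p1 p2
  have c1 := compare hG hcT hGi hint p1 p2
  have c2 := compare hcT hG (hint ▸ hGi) hint.symm p2 p1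
  filter_upwards [c1, c2] with x hx1 hx2 hx
  exact le_antisymm (hx1 hx) (hx2 hx)

end ExpChar

/-- Characterization of exponential densities: if a measurable probability density
`g` on `[0,∞)` satisfies `g(x) = 2∫₀^∞ g(x+y)g(y) dy` for every `x ≥ 0`, then
`g(x) = λe^{-λx}` on `[0,∞)` for some `λ > 0`. -/
theorem stmt18 (g : ℝ → ℝ) (hmeas : Measurable g) (hnn : ∀ x, 0 ≤ g x)
    (hsupp : ∀ x : ℝ, x < 0 → g x = 0)
    (hdens : ∫ x in Set.Ioi (0 : ℝ), g x = 1)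
    (heq : ∀ x : ℝ, 0 ≤ x → g x = 2 * ∫ y in Set.Ioi (0 : ℝ), g (x + y) * g y) :
    ∃ lam : ℝ, 0 < lam ∧ ∀ x : ℝ, 0 ≤ x → g x = lam * Real.exp (-lam * x) := by
  classical
  have hgi : IntegrableOn g (Ioi (0:ℝ)) := by
    by_contra h
    rw [integral_undef h] at hdens
    exact zero_ne_one hdens
  set G : ℝ → ℝ≥0∞ := (Ioi (0:ℝ)).indicator (fun x => ENNReal.ofReal (g x)) with hGdef
  have hGpos : ∀ x, 0 < x → G x = ENNReal.ofReal (g x) := fun x hx => by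
    simp [hGdef, indicator, hx]
  have hG : Measurable G := (by fun_prop : Measurable fun x => ENNReal.ofReal (g x)).indicator
    measurableSet_Ioi
  have hG0 : ∀ x ≤ 0, G x = 0 := fun x hx => by simp [hGdef, indicator, not_lt.2 hx]
  have h1 : ∫⁻ x, G x = 1 := by
    rw [hGdef, lintegral_indicator measurableSet_Ioi,
      ← ofReal_integral_eq_lintegral_ofReal hgi (Eventually.of_forall hnn), hdens, ENNReal.ofReal_one]
  have hfin : ∀ x, G x ≠ ⊤ := fun x => by
    rcases le_or_gt x 0 with h | h
    · simp [hG0 x h]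
    · simp [hGpos x h]
  have hinv : ∀ᵐ z : ℝ, 0 < z → ExpChar.P G G z = G z := by
    have hm := ExpChar.mass hG h1 hG
    have hT := ExpChar.T_zero hG0 h1
    rw [ExpChar.T] at hT
    rw [hT] at hm
    have := ae_lt_top (ExpChar.measP hG hG) (hm ▸ ENNReal.one_ne_top)
    rw [ae_restrict_iff' measurableSet_Ioi] at this
    filter_upwards [this] with z hz hz0
    have hz := hz hz0
    rw [ExpChar.P_self hG hG0 hz0.le] at hz ⊢
    have e : ∫⁻ y in Ioi (0:ℝ), G (z + y) * G y
        = ∫⁻ y in Ioi (0:ℝ), ENNReal.ofReal (g (z + y) * g y) := by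
      refine setLIntegral_congr_fun measurableSet_Ioi fun y hy => ?_
      have hy : 0 < y := hy
      rw [hGpos _ (by linarith), hGpos _ hy, ENNReal.ofReal_mul (hnn _)]
    have hLtop : ∫⁻ y in Ioi (0:ℝ), G (z + y) * G y ≠ ⊤ := by
      intro h
      rw [h] at hz
      simp at hz
    rw [hGpos z hz0, heq z hz0.le, integral_eq_lintegral_of_nonneg_ae
      (Eventually.of_forall fun y => mul_nonneg (hnn _) (hnn _))
      (by fun_prop : Measurable fun y => g (z + y) * g y).aestronglyMeasurable, ← e,
      ENNReal.ofReal_mul (by norm_num), ENNReal.ofReal_toReal hLtop]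
    simp
  obtain ⟨c, hc, hcT⟩ := ExpChar.main_ae hG hG0 h1 hfin hinv
  set l := c.toReal with hl
  have hg : Integrable g := by
    rw [← integrableOn_univ, ← Iic_union_Ioi (a := (0:ℝ))]
    refine IntegrableOn.union ?_ hgi
    rw [integrableOn_Iic_iff_integrableOn_Iio]
    exact (integrableOn_zero).congr_fun (fun x hx => (hsupp x hx).symm) measurableSet_Iio
  set Q : ℝ → ℝ := fun x => 1 - ∫ t in (0:ℝ)..x, g t with hQ
  have hQc : Continuous Q :=
    continuous_const.sub (intervalIntegral.continuous_primitive (fun a b => hg.intervalIntegrable) 0)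
  have hQT : ∀ x, 0 ≤ x → (ExpChar.T G x).toReal = Q x := by
    intro x hx
    have := intervalIntegral.integral_interval_add_Ioi (f := g) (μ := volume) (a := 0) (b := x)
      hg.integrableOn hg.integrableOn
    rw [hdens] at this
    simp only [hQ]
    rw [← this, add_sub_cancel_left, ExpChar.T,
      integral_eq_lintegral_of_nonneg_ae (Eventually.of_forall hnn) hmeas.aestronglyMeasurable]
    congr 1
    refine setLIntegral_congr_fun measurableSet_Ioi fun y hy => ?_
    exact hGpos y (lt_of_le_of_lt hx hy)
  have hae : ∀ᵐ x : ℝ, 0 < x → g x = l * Q x := by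
    filter_upwards [hcT] with x hx hx0
    have := congrArg ENNReal.toReal (hx hx0)
    rwa [hGpos x hx0, ENNReal.toReal_ofReal (hnn x), ENNReal.toReal_mul, hQT x hx0.le] at this
  set F : ℝ → ℝ := fun x => 1 - ∫ t in (0:ℝ)..x, l * Q t with hF
  have hQF : ∀ x, 0 ≤ x → Q x = F x := by
    intro x hx
    simp only [hQ, hF]
    congr 1
    apply intervalIntegral.integral_congr_ae
    filter_upwards [hae] with t ht ht2
    rw [uIoc_of_le hx] at ht2
    exact ht ht2.1
  have hFd : ∀ x, HasDerivAt F (-(l * Q x)) x := by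
    intro x
    have hc : Continuous fun t => l * Q t := by fun_prop
    exact (intervalIntegral.integral_hasDerivAt_right (hc.intervalIntegrable _ _)
      (hc.stronglyMeasurableAtFilter _ _) hc.continuousAt).const_sub 1
  have hFe : ∀ x, 0 ≤ x → F x * Real.exp (l * x) = 1 := by
    intro x hx
    have hd : ∀ y, HasDerivAt (fun y => F y * Real.exp (l * y))
        (-(l * Q y) * Real.exp (l * y) + F y * (Real.exp (l * y) * (l * 1))) y := fun y =>
      (hFd y).mul (((hasDerivAt_id y).const_mul l).exp)
    have := constant_of_has_deriv_right_zero (f := fun y => F y * Real.exp (l * y)) (a := 0) (b := x)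
      (fun y _ => (hd y).continuousAt.continuousWithinAt) (fun y hy => by
        have := (hd y).hasDerivWithinAt (s := Ici y)
        rw [hQF y hy.1] at this
        convert this using 1
        ring) x ⟨hx, le_rfl⟩
    rw [this]
    simp [hF]
  have hQe : ∀ x, 0 ≤ x → Q x = Real.exp (-l * x) := by
    intro x hx
    rw [hQF x hx, neg_mul, Real.exp_neg]
    exact eq_inv_of_mul_eq_one_left (hFe x hx)
  have hae2 : ∀ᵐ x : ℝ, 0 < x → g x = l * Real.exp (-l * x) := by
    filter_upwards [hae] with x hx hx0
    rw [hx hx0, hQe x hx0.le]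
  have hl0 : 0 < l := by
    refine lt_of_le_of_ne ENNReal.toReal_nonneg fun h => ?_
    have : ∫ x in Ioi (0:ℝ), g x = 0 := by
      refine setIntegral_eq_zero_of_ae_eq_zero ?_
      filter_upwards [hae2] with x hx hx0
      rw [hx hx0, ← h, zero_mul]
    rw [this] at hdens
    exact zero_ne_one hdens
  refine ⟨l, hl0, fun x hx => ?_⟩
  have hsh := (measurePreserving_add_left (volume : Measure ℝ) x).quasiMeasurePreserving.ae hae2
  have : ∫ y in Ioi (0:ℝ), g (x + y) * g y
      = ∫ y in Ioi (0:ℝ), (l ^ 2 * Real.exp (-l * x)) * Real.exp ((-2 * l) * y) := by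
    refine setIntegral_congr_ae measurableSet_Ioi ?_
    filter_upwards [hae2, hsh] with y hy hy2 hy0
    have hy0 : 0 < y := hy0
    rw [hy hy0, hy2 (by linarith)]
    have : Real.exp (-l * (x + y)) * Real.exp (-l * y)
        = Real.exp (-l * x) * Real.exp (-2 * l * y) := by
      rw [← Real.exp_add, ← Real.exp_add]; ring_nf
    linear_combination l ^ 2 * this
  rw [heq x hx, this, integral_const_mul, integral_exp_mul_Ioi (by linarith)]
  simp
  field_simp
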